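/- L(5) = 3: every C(5)-free family of nonempty compact convex sets in the plane can be pierced by 3 lines, and there exists a C(5)-free family of compact convex sets that cannot be pierced by 2 lines. -/

import Mathlib

open Set

noncomputable section

abbrev Plane := EuclideanSpace ℝ (Fin 2)

/-- A line in the plane: a point plus a nonzero direction. -/
def IsLine (L : Set Plane) : Prop :=
  ∃ p v : Plane, v ≠ 0 ∧ L = {x | ∃ t : ℝ, x = p + t • v}

/-- A `C(k)` family: `k` distinct sets such that the convex hulls of consecutive
unions are disjoint whenever the index pairs (mod `k`) are disjoint. -/
def IsCk (k : ℕ) [NeZero k] (F : Fin k → Set Plane) : Prop :=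
  Function.Injective F ∧
  ∀ i j : Fin k, Disjoint ({i, i + 1} : Finset (Fin k)) ({j, j + 1} : Finset (Fin k)) →
    convexHull ℝ (F i ∪ F (i + 1)) ∩ convexHull ℝ (F j ∪ F (j + 1)) = ∅

theorem topo_up (A B C D : ℝ → ℝ → Prop)
    (hCD : ∀ p q, C p q ∨ D p q)
    (Aup : ∀ p q q', q ≤ q' → A p q → A p q')
    (Bdn : ∀ p q q', q' ≤ q → B p q → B p q') (Cdn : ∀ p q q', q' ≤ q → C p q → C p q')
    (s1 : ∀ p q, A p q → C p q → ∃ ε > 0, ∀ p' q', |p' - p| < ε → |q' - q| < ε →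
      ¬ (B p' q' ∧ D p' q'))
    (s3 : ∀ p q, A p q → D p q → ∃ ε > 0, ∀ p' q', |p' - p| < ε → |q' - q| < ε →
      ¬ (B p' q' ∧ C p' q'))
    (p q0 : ℝ) (hA0 : A p q0) (hC0 : C p q0) (q : ℝ) (hq : q0 ≤ q) :
    ∃ ε > 0, ∀ p' q', |p' - p| < ε → |q' - q| < ε → ¬ (B p' q' ∧ D p' q') := by
  have hA := Aup p q0 q hq hA0
  by_cases hC : C p q
  · exact s1 p q hA hC
  set E : Set ℝ := {t | q0 ≤ t ∧ C p t} with hE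
  have hEne : E.Nonempty := ⟨q0, le_refl _, hC0⟩
  have hEb : ∀ t ∈ E, t < q := by
    intro t ht
    by_contra h
    exact hC (Cdn p t q (not_lt.mp h) ht.2)
  have hbdd : BddAbove E := ⟨q, fun t ht => (hEb t ht).le⟩
  set r := sSup E with hr
  have hr0 : q0 ≤ r := le_csSup hbdd ⟨le_refl _, hC0⟩
  have hrq : r ≤ q := csSup_le hEne fun t ht => (hEb t ht).le
  have hAr := Aup p q0 r hr0 hA0
  by_cases hCr : C p r
  · have hlt : r < q := hEb r ⟨hr0, hCr⟩
    obtain ⟨ε, hε, h1⟩ := s1 p r hAr hCr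
    obtain ⟨t, ht1, ht2⟩ := exists_between (lt_min hlt (lt_add_of_pos_right r hε))
    have htq : t < q := lt_of_lt_of_le ht2 (min_le_left _ _)
    have htr : t < r + ε := lt_of_lt_of_le ht2 (min_le_right _ _)
    have hCt : ¬ C p t := fun h => absurd (le_csSup hbdd (show t ∈ E from ⟨by linarith, h⟩)) (by
      rw [← hr]; exact not_le.mpr ht1)
    have hDt := (hCD p t).resolve_left hCt
    obtain ⟨δ, hδ, h3⟩ := s3 p t (Aup p q0 t (by linarith) hA0) hDt
    refine ⟨min (min ε δ) (q - t), lt_min (lt_min hε hδ) (by linarith), ?_⟩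
    rintro p' q' hp hq' ⟨hB, hD⟩
    simp only [lt_min_iff] at hp hq'
    have htq' : t ≤ q' := by have := abs_lt.mp hq'.2; linarith
    have hBt := Bdn p' q' t htq' hB
    have h3' := h3 p' t hp.1.2 (by simpa using hδ)
    have hDt' : D p' t := (hCD p' t).resolve_left fun h => h3' ⟨hBt, h⟩
    exact h1 p' t hp.1.1 (by rw [abs_lt]; constructor <;> linarith) ⟨hBt, hDt'⟩
  · have hDr := (hCD p r).resolve_left hCr
    obtain ⟨ε, hε, h3⟩ := s3 p r hAr hDr
    obtain ⟨t, ht, ht1⟩ := exists_lt_of_lt_csSup hEne (show r - ε < sSup E by rw [← hr]; linarith)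
    have ht2 : t ≤ r := le_csSup hbdd ht
    have ht3 : t < q := hEb t ht
    obtain ⟨δ, hδ, h1⟩ := s1 p t (Aup p q0 t ht.1 hA0) ht.2
    refine ⟨min (min ε δ) (q - t), lt_min (lt_min hε hδ) (by linarith), ?_⟩
    rintro p' q' hp hq' ⟨hB, hD⟩
    simp only [lt_min_iff] at hp hq'
    have htq' : t ≤ q' := by have := abs_lt.mp hq'.2; linarith
    have hBt := Bdn p' q' t htq' hB
    have h1' := h1 p' t hp.1.2 (by simpa using hδ)
    have hCt' : C p' t := (hCD p' t).resolve_right fun h => h1' ⟨hBt, h⟩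
    exact h3 p' t hp.1.1 (by rw [abs_lt]; constructor <;> linarith) ⟨hBt, hCt'⟩

theorem topo_claim (A B C D : ℝ → ℝ → Prop) (Y : ℝ)
    (hAB : ∀ p q, A p q ∨ B p q)
    (hCD : ∀ p q, C p q ∨ D p q)
    (Aup : ∀ p q q', q ≤ q' → A p q → A p q') (Dup : ∀ p q q', q ≤ q' → D p q → D p q')
    (Bdn : ∀ p q q', q' ≤ q → B p q → B p q') (Cdn : ∀ p q q', q' ≤ q → C p q → C p q')
    (s1 : ∀ p q, A p q → C p q → ∃ ε > 0, ∀ p' q', |p' - p| < ε → |q' - q| < ε →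
      ¬ (B p' q' ∧ D p' q'))
    (s3 : ∀ p q, A p q → D p q → ∃ ε > 0, ∀ p' q', |p' - p| < ε → |q' - q| < ε →
      ¬ (B p' q' ∧ C p' q'))
    (s4 : ∀ p q, B p q → C p q → ∃ ε > 0, ∀ p' q', |p' - p| < ε → |q' - q| < ε →
      ¬ (A p' q' ∧ D p' q'))
    (p q0 : ℝ) (hA0 : A p q0) (hC0 : C p q0) :
    ∀ᶠ p' in nhds p, ∀ q' ∈ Icc (-Y) Y, ¬ (B p' q' ∧ D p' q') := by
  have key : ∀ q, ∃ ε > 0, ∀ p' q', |p' - p| < ε → |q' - q| < ε → ¬ (B p' q' ∧ D p' q') := by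
    intro q
    rcases le_total q0 q with hq | hq
    · exact topo_up A B C D hCD Aup Bdn Cdn s1 s3 p q0 hA0 hC0 q hq
    · obtain ⟨ε, hε, h⟩ := topo_up (fun p q => C p (-q)) (fun p q => D p (-q))
        (fun p q => A p (-q)) (fun p q => B p (-q))
        (fun p q => hAB p (-q)) (fun p q q' h => Cdn _ _ _ (by linarith))
        (fun p q q' h => Dup _ _ _ (by linarith)) (fun p q q' h => Aup _ _ _ (by linarith))
        (by
          intro p q h1 h2
          obtain ⟨ε, hε, h⟩ := s1 p (-q) h2 h1
          refine ⟨ε, hε, fun p' q' hp hq hh => h p' (-q') hp ?_ ⟨hh.2, hh.1⟩⟩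
          rw [← abs_neg]; convert hq using 2; ring)
        (by
          intro p q h1 h2
          obtain ⟨ε, hε, h⟩ := s4 p (-q) h2 h1
          refine ⟨ε, hε, fun p' q' hp hq hh => h p' (-q') hp ?_ ⟨hh.2, hh.1⟩⟩
          rw [← abs_neg]; convert hq using 2; ring)
        p (-q0) (by simpa using hC0) (by simpa using hA0) (-q) (by linarith)
      refine ⟨ε, hε, fun p' q' hp hq hh => h p' (-q') hp ?_
        ⟨by simpa using hh.2, by simpa using hh.1⟩⟩
      rw [← abs_neg]; convert hq using 2; ring
  refine (isCompact_Icc : IsCompact (Icc (-Y) Y)).eventually_forall_of_forall_eventually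
    (P := fun p' q' => ¬ (B p' q' ∧ D p' q')) ?_
  intro q _
  obtain ⟨ε, hε, h⟩ := key q
  rw [Metric.eventually_nhds_iff]
  refine ⟨ε, hε, fun z hz => ?_⟩
  rw [Prod.dist_eq, max_lt_iff, Real.dist_eq, Real.dist_eq] at hz
  exact h z.1 z.2 hz.1 hz.2

theorem topo_slice (A B C D : ℝ → ℝ → Prop) (Y : ℝ)
    (hAB : ∀ p q, A p q ∨ B p q)
    (hCD : ∀ p q, C p q ∨ D p q)
    (Cdn : ∀ p q q', q' ≤ q → C p q → C p q')
    (s3 : ∀ p q, A p q → D p q → ∃ ε > 0, ∀ p' q', |p' - p| < ε → |q' - q| < ε →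
      ¬ (B p' q' ∧ C p' q'))
    (s4 : ∀ p q, B p q → C p q → ∃ ε > 0, ∀ p' q', |p' - p| < ε → |q' - q| < ε →
      ¬ (A p' q' ∧ D p' q')) (hY : 0 < Y) (p : ℝ)
    (hD : A p Y ∧ D p Y) (hB : B p (-Y) ∧ C p (-Y)) :
    ∃ q ∈ Icc (-Y) Y, (A p q ∧ C p q) ∨ (B p q ∧ D p q) := by
  by_contra! hcon
  set E : Set ℝ := {t | t ∈ Icc (-Y) Y ∧ C p t} with hE
  have hm : -Y ∈ E := ⟨⟨le_refl _, by linarith⟩, hB.2⟩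
  have hbdd : BddAbove E := ⟨Y, fun t ht => ht.1.2⟩
  set r := sSup E with hr
  have hr0 : -Y ≤ r := le_csSup hbdd hm
  have hrY : r ≤ Y := csSup_le ⟨_, hm⟩ fun t ht => ht.1.2
  have hc := hcon r ⟨hr0, hrY⟩
  by_cases hC : C p r
  · have hBr : B p r := (hAB p r).resolve_left fun h => hc.1 h hC
    obtain ⟨ε, hε, h4⟩ := s4 p r hBr hC
    have hlt : r < Y := by
      refine lt_of_le_of_ne hrY fun h => ?_
      exact hc.2 hBr (h ▸ hD.2)
    obtain ⟨t, ht1, ht2⟩ := exists_between (lt_min hlt (lt_add_of_pos_right r hε))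
    rw [lt_min_iff] at ht2
    have hCt : ¬ C p t := fun h => absurd
      (le_csSup hbdd (show t ∈ E from ⟨⟨by linarith, ht2.1.le⟩, h⟩)) (by
      rw [← hr]; exact not_le.mpr ht1)
    have hDt := (hCD p t).resolve_left hCt
    have hct := hcon t ⟨by linarith, ht2.1.le⟩
    have hAt := (hAB p t).resolve_right fun h => hct.2 h hDt
    exact h4 p t (by simpa using hε) (by rw [abs_lt]; constructor <;> linarith) ⟨hAt, hDt⟩
  · have hDr := (hCD p r).resolve_left hC
    have hAr : A p r := (hAB p r).resolve_right fun h => hc.2 h hDr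
    obtain ⟨ε, hε, h3⟩ := s3 p r hAr hDr
    obtain ⟨t, ht, ht1⟩ := exists_lt_of_lt_csSup ⟨_, hm⟩
      (show r - ε < sSup E by rw [← hr]; linarith)
    have ht2 : t ≤ r := le_csSup hbdd ht
    have hct := hcon t ht.1
    have hBt := (hAB p t).resolve_left fun h => hct.1 h ht.2
    exact h3 p t (by simpa using hε) (by rw [abs_lt]; constructor <;> linarith) ⟨hBt, ht.2⟩

theorem topo_main (A B C D : ℝ → ℝ → Prop) (Y : ℝ) (hY : 0 < Y)
    (hAB : ∀ p q, A p q ∨ B p q)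
    (hCD : ∀ p q, C p q ∨ D p q)
    (Aup : ∀ p q q', q ≤ q' → A p q → A p q') (Dup : ∀ p q q', q ≤ q' → D p q → D p q')
    (Bdn : ∀ p q q', q' ≤ q → B p q → B p q') (Cdn : ∀ p q q', q' ≤ q → C p q → C p q')
    (s1 : ∀ p q, A p q → C p q → ∃ ε > 0, ∀ p' q', |p' - p| < ε → |q' - q| < ε →
      ¬ (B p' q' ∧ D p' q'))
    (s2 : ∀ p q, B p q → D p q → ∃ ε > 0, ∀ p' q', |p' - p| < ε → |q' - q| < ε →
      ¬ (A p' q' ∧ C p' q'))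
    (s3 : ∀ p q, A p q → D p q → ∃ ε > 0, ∀ p' q', |p' - p| < ε → |q' - q| < ε →
      ¬ (B p' q' ∧ C p' q'))
    (s4 : ∀ p q, B p q → C p q → ∃ ε > 0, ∀ p' q', |p' - p| < ε → |q' - q| < ε →
      ¬ (A p' q' ∧ D p' q'))
    (hends : ∀ p, (∀ q, A p q ∧ C p q) ∨ (∀ q, B p q ∧ D p q) ∨
      ((A p Y ∧ D p Y) ∧ (B p (-Y) ∧ C p (-Y))))
    (hl : ∃ p, ∀ q, A p q ∧ C p q) (hr : ∃ p, ∀ q, B p q ∧ D p q) : False := by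
  set P : Set ℝ := {p | ∃ q ∈ Icc (-Y) Y, A p q ∧ C p q}
  set Q : Set ℝ := {p | ∃ q ∈ Icc (-Y) Y, B p q ∧ D p q}
  have h0 : (0 : ℝ) ∈ Icc (-Y) Y := ⟨by linarith, hY.le⟩
  have hcov : ∀ p, p ∈ P ∨ p ∈ Q := by
    intro p
    rcases hends p with h | h | h
    · exact Or.inl ⟨0, h0, h 0⟩
    · exact Or.inr ⟨0, h0, h 0⟩
    · obtain ⟨q, hq, h' | h'⟩ := topo_slice A B C D Y hAB hCD Cdn s3 s4 hY p h.1 h.2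
      · exact Or.inl ⟨q, hq, h'⟩
      · exact Or.inr ⟨q, hq, h'⟩
  have hPQ : ∀ p ∈ P, ∀ᶠ p' in nhds p, p' ∉ Q := by
    rintro p ⟨q0, _, hA, hC⟩
    filter_upwards [topo_claim A B C D Y hAB hCD Aup Dup Bdn Cdn s1 s3 s4 p q0 hA hC] with p' h
    rintro ⟨q, hq, h'⟩
    exact h q hq h'
  have hQP : ∀ p ∈ Q, ∀ᶠ p' in nhds p, p' ∉ P := by
    rintro p ⟨q0, _, hB, hD⟩
    filter_upwards [topo_claim D C B A Y (fun p q => (hCD p q).symm) (fun p q => (hAB p q).symm)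
      Dup Aup Cdn Bdn
      (fun p q h1 h2 => by
        obtain ⟨ε, hε, h⟩ := s2 p q h2 h1
        exact ⟨ε, hε, fun p' q' a b hh => h p' q' a b hh.symm⟩)
      (fun p q h1 h2 => by
        obtain ⟨ε, hε, h⟩ := s3 p q h2 h1
        exact ⟨ε, hε, fun p' q' a b hh => h p' q' a b hh.symm⟩)
      (fun p q h1 h2 => by
        obtain ⟨ε, hε, h⟩ := s4 p q h2 h1
        exact ⟨ε, hε, fun p' q' a b hh => h p' q' a b hh.symm⟩) p q0 hD hB] with p' h
    rintro ⟨q, hq, h'⟩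
    exact h q hq h'.symm
  have hPo : IsOpen P := isOpen_iff_mem_nhds.mpr fun p hp => by
    filter_upwards [hPQ p hp] with p' h using (hcov p').resolve_right h
  have hQo : IsOpen Q := isOpen_iff_mem_nhds.mpr fun p hp => by
    filter_upwards [hQP p hp] with p' h using (hcov p').resolve_left h
  obtain ⟨a, ha⟩ := hl
  obtain ⟨b, hb⟩ := hr
  obtain ⟨x, -, hxP, hxQ⟩ := isPreconnected_univ P Q hPo hQo (fun p _ => hcov p)
    ⟨a, trivial, 0, h0, ha 0⟩ ⟨b, trivial, 0, h0, hb 0⟩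
  exact (hPQ x hxP).self_of_nhds hxQ

def sl (p q : ℝ) (z : Plane) : ℝ := (z 1 - q) / (z 0 - p)

def Sd (s : Bool) (p : ℝ) (S : Set Plane) : Prop :=
  if s then ∀ z ∈ S, p < z 0 else ∀ z ∈ S, z 0 < p

def bt (S : Set Plane) (p q : ℝ) : ℝ := sSup (sl p q '' S)

def ab (S : Set Plane) (p q : ℝ) : ℝ := sInf (sl p q '' S)

def Good (S : Set Plane) : Prop := S.Nonempty ∧ IsCompact S ∧ Convex ℝ S

theorem cont0 : Continuous fun z : Plane => z 0 := by fun_prop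
theorem cont1 : Continuous fun z : Plane => z 1 := by fun_prop

theorem Sd.ne {s : Bool} {p : ℝ} {S : Set Plane} (h : Sd s p S) : ∀ z ∈ S, z 0 - p ≠ 0 := by
  intro z hz
  cases s
  · have : z 0 < p := (by simpa [Sd] using h : ∀ z ∈ S, z 0 < p) z hz
    exact (by linarith : z 0 - p < 0).ne
  · have : p < z 0 := (by simpa [Sd] using h : ∀ z ∈ S, p < z 0) z hz
    exact (by linarith : 0 < z 0 - p).ne'

theorem sl_cont {s : Bool} {p q : ℝ} {S : Set Plane} (h : Sd s p S) : ContinuousOn (sl p q) S := by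
  unfold sl
  exact ContinuousOn.div (by fun_prop) (by fun_prop) h.ne

theorem img_cpt {s : Bool} {p q : ℝ} {S : Set Plane} (hS : Good S) (h : Sd s p S) :
    IsCompact (sl p q '' S) := hS.2.1.image_of_continuousOn (sl_cont h)

theorem bt_lt_iff {s : Bool} {p q m : ℝ} {S : Set Plane} (hS : Good S) (h : Sd s p S) :
    bt S p q < m ↔ ∀ z ∈ S, sl p q z < m :=
  hS.2.1.sSup_lt_iff_of_continuous hS.1 (sl_cont h) m

theorem lt_ab_iff {s : Bool} {p q m : ℝ} {S : Set Plane} (hS : Good S) (h : Sd s p S) :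
    m < ab S p q ↔ ∀ z ∈ S, m < sl p q z :=
  hS.2.1.lt_sInf_iff_of_continuous hS.1 (sl_cont h) m

theorem le_bt {s : Bool} {p q : ℝ} {S : Set Plane} (hS : Good S) (h : Sd s p S) :
    ∀ z ∈ S, sl p q z ≤ bt S p q := fun z hz =>
  le_csSup (img_cpt hS h).bddAbove ⟨z, hz, rfl⟩

theorem ab_le {s : Bool} {p q : ℝ} {S : Set Plane} (hS : Good S) (h : Sd s p S) :
    ∀ z ∈ S, ab S p q ≤ sl p q z := fun z hz =>
  csInf_le (img_cpt hS h).bddBelow ⟨z, hz, rfl⟩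

theorem ab_le_bt {s : Bool} {p q : ℝ} {S : Set Plane} (hS : Good S) (h : Sd s p S) :
    ab S p q ≤ bt S p q := by
  obtain ⟨z, hz⟩ := hS.1
  exact (ab_le hS h z hz).trans (le_bt hS h z hz)

theorem bt_att {s : Bool} {p q : ℝ} {S : Set Plane} (hS : Good S) (h : Sd s p S) :
    ∃ z ∈ S, sl p q z = bt S p q := (img_cpt hS h).sSup_mem (hS.1.image _)

theorem ab_att {s : Bool} {p q : ℝ} {S : Set Plane} (hS : Good S) (h : Sd s p S) :
    ∃ z ∈ S, sl p q z = ab S p q := (img_cpt hS h).sInf_mem (hS.1.image _)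

/-- intermediate slopes are attained -/
theorem sl_mid {s : Bool} {p q m : ℝ} {S : Set Plane} (hS : Good S) (h : Sd s p S)
    (h1 : ab S p q ≤ m) (h2 : m ≤ bt S p q) : ∃ z ∈ S, z 1 - q = m * (z 0 - p) := by
  obtain ⟨a, ha, ha'⟩ := ab_att (q := q) hS h
  obtain ⟨b, hb, hb'⟩ := bt_att (q := q) hS h
  obtain ⟨z, hz, hz'⟩ := hS.2.2.isPreconnected.intermediate_value ha hb (sl_cont (q := q) h)
    (show m ∈ Icc _ _ by rw [ha', hb']; exact ⟨h1, h2⟩)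
  refine ⟨z, hz, ?_⟩
  rw [← hz', sl, div_mul_cancel₀ _ (h.ne z hz)]

theorem sd_or {p : ℝ} {S : Set Plane} (hS : Good S) (h : ¬ ∃ z ∈ S, z 0 = p) :
    ∃ s, Sd s p S := by
  by_contra! hc
  have h1 : ¬ ∀ z ∈ S, p < z 0 := by simpa [Sd] using hc true
  have h2 : ¬ ∀ z ∈ S, z 0 < p := by simpa [Sd] using hc false
  push Not at h1 h2
  obtain ⟨a, ha, ha'⟩ := h1
  obtain ⟨b, hb, hb'⟩ := h2
  obtain ⟨z, hz, hz'⟩ := hS.2.2.isPreconnected.intermediate_value ha hb cont0.continuousOn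
    (show p ∈ Icc _ _ from ⟨ha', hb'⟩)
  exact h ⟨z, hz, hz'⟩

theorem sl_right {p q q' : ℝ} {z : Plane} (hq : q ≤ q') (h : p < z 0) : sl p q' z ≤ sl p q z := by
  unfold sl
  exact div_le_div_of_nonneg_right (by linarith) (by linarith)

theorem sl_left {p q q' : ℝ} {z : Plane} (hq : q ≤ q') (h : z 0 < p) : sl p q z ≤ sl p q' z := by
  unfold sl
  exact div_le_div_of_nonpos_of_le (by linarith) (by linarith)

theorem bt_right {p q q' : ℝ} {S : Set Plane} (hS : Good S) (h : Sd true p S) (hq : q ≤ q') :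
    bt S p q' ≤ bt S p q := by
  obtain ⟨z, hz, e⟩ := bt_att (q := q') hS h
  rw [← e]
  exact (sl_right hq (by simpa [Sd] using h z hz)).trans (le_bt hS h z hz)

theorem bt_left {p q q' : ℝ} {S : Set Plane} (hS : Good S) (h : Sd false p S) (hq : q ≤ q') :
    bt S p q ≤ bt S p q' := by
  obtain ⟨z, hz, e⟩ := bt_att (q := q) hS h
  rw [← e]
  exact (sl_left hq (by simpa [Sd] using h z hz)).trans (le_bt hS h z hz)

theorem ab_right {p q q' : ℝ} {S : Set Plane} (hS : Good S) (h : Sd true p S) (hq : q ≤ q') :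
    ab S p q' ≤ ab S p q := by
  obtain ⟨z, hz, e⟩ := ab_att (q := q) hS h
  rw [← e]
  exact (ab_le hS h z hz).trans (sl_right hq (by simpa [Sd] using h z hz))

theorem ab_left {p q q' : ℝ} {S : Set Plane} (hS : Good S) (h : Sd false p S) (hq : q ≤ q') :
    ab S p q ≤ ab S p q' := by
  obtain ⟨z, hz, e⟩ := ab_att (q := q') hS h
  rw [← e]
  exact (ab_le hS h z hz).trans (sl_left hq (by simpa [Sd] using h z hz))

/-- openness of strict conditions -/
theorem open_sd {s : Bool} {p q : ℝ} {S : Set Plane} (hS : Good S) (h : Sd s p S) :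
    ∀ᶠ w : ℝ × ℝ in nhds (p, q), Sd s w.1 S := by
  cases s
  · have : ∀ᶠ w : ℝ × ℝ in nhds (p, q), ∀ z ∈ S, z 0 < w.1 := by
      refine hS.2.1.eventually_forall_of_forall_eventually
        (P := fun (w : ℝ × ℝ) (z : Plane) => z 0 < w.1) fun z hz => ?_
      have hz' : z 0 < p := by simpa [Sd] using h z hz
      exact (isOpen_lt (f := fun u : (ℝ × ℝ) × Plane => u.2 0) (g := fun u => u.1.1)
        (by fun_prop) (by fun_prop)).mem_nhds hz'
    filter_upwards [this] with w hw
    simpa [Sd] using hw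
  · have : ∀ᶠ w : ℝ × ℝ in nhds (p, q), ∀ z ∈ S, w.1 < z 0 := by
      refine hS.2.1.eventually_forall_of_forall_eventually
        (P := fun (w : ℝ × ℝ) (z : Plane) => w.1 < z 0) fun z hz => ?_
      have hz' : p < z 0 := by simpa [Sd] using h z hz
      exact (isOpen_lt (g := fun u : (ℝ × ℝ) × Plane => u.2 0) (f := fun u => u.1.1)
        (by fun_prop) (by fun_prop)).mem_nhds hz'
    filter_upwards [this] with w hw
    simpa [Sd] using hw

theorem sl_contAt {p q : ℝ} {z : Plane} (h : z 0 - p ≠ 0) :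
    ContinuousAt (fun u : (ℝ × ℝ) × Plane => sl u.1.1 u.1.2 u.2) ((p, q), z) := by
  unfold sl
  exact ContinuousAt.div (by fun_prop) (by fun_prop) h

theorem open_bt {s : Bool} {p q m : ℝ} {S : Set Plane} (hS : Good S) (h : Sd s p S)
    (hm : bt S p q < m) : ∀ᶠ w : ℝ × ℝ in nhds (p, q), ∀ z ∈ S, sl w.1 w.2 z < m := by
  refine hS.2.1.eventually_forall_of_forall_eventually
        (P := fun (w : ℝ × ℝ) (z : Plane) => sl w.1 w.2 z < m) fun z hz => ?_
  exact (sl_contAt (h.ne z hz)).eventually_lt_const ((bt_lt_iff hS h).mp hm z hz)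

theorem open_ab {s : Bool} {p q m : ℝ} {S : Set Plane} (hS : Good S) (h : Sd s p S)
    (hm : m < ab S p q) : ∀ᶠ w : ℝ × ℝ in nhds (p, q), ∀ z ∈ S, m < sl w.1 w.2 z := by
  refine hS.2.1.eventually_forall_of_forall_eventually
        (P := fun (w : ℝ × ℝ) (z : Plane) => m < sl w.1 w.2 z) fun z hz => ?_
  exact (sl_contAt (h.ne z hz)).eventually_const_lt ((lt_ab_iff hS h).mp hm z hz)

/-- separation by an affine function -/
theorem sep_hull {A B C D : Set Plane} (a b c : ℝ)
    (hA : ∀ z ∈ A, a * z 0 + b * z 1 + c < 0) (hB : ∀ z ∈ B, a * z 0 + b * z 1 + c < 0)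
    (hC : ∀ z ∈ C, 0 < a * z 0 + b * z 1 + c) (hD : ∀ z ∈ D, 0 < a * z 0 + b * z 1 + c) :
    convexHull ℝ (A ∪ B) ∩ convexHull ℝ (C ∪ D) = ∅ := by
  have lin : IsLinearMap ℝ fun z : Plane => a * z 0 + b * z 1 :=
    ⟨fun x y => by simp; ring, fun t x => by simp; ring⟩
  have h1 : convexHull ℝ (A ∪ B) ⊆ {z : Plane | a * z 0 + b * z 1 < -c} := by
    refine convexHull_min ?_ (convex_halfSpace_lt lin _)
    rintro z (hz | hz)
    · have := hA z hz
      simp only [mem_ofPred_eq]; linarith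
    · have := hB z hz
      simp only [mem_ofPred_eq]; linarith
  have h2 : convexHull ℝ (C ∪ D) ⊆ {z : Plane | -c < a * z 0 + b * z 1} := by
    refine convexHull_min ?_ (convex_halfSpace_gt lin _)
    rintro z (hz | hz)
    · have := hC z hz
      simp only [mem_ofPred_eq]; linarith
    · have := hD z hz
      simp only [mem_ofPred_eq]; linarith
  ext z
  simp only [mem_inter_iff, mem_empty_iff_false, iff_false, not_and]
  intro hz hz'
  have a1 := h1 hz
  have a2 := h2 hz'
  simp only [mem_ofPred_eq] at a1 a2
  linarith

/-- In a cyclic family satisfying the hull condition two different members are disjoint. -/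
theorem hull_disj {G : Fin 5 → Set Plane}
    (h : ∀ i j : Fin 5, Disjoint ({i, i + 1} : Finset (Fin 5)) ({j, j + 1} : Finset (Fin 5)) →
    convexHull ℝ (G i ∪ G (i + 1)) ∩ convexHull ℝ (G j ∪ G (j + 1)) = ∅) {i j : Fin 5}
    (hij : i ≠ j) : G i ∩ G j = ∅ := by
  have : ∃ a b : Fin 5, Disjoint ({a, a + 1} : Finset (Fin 5)) ({b, b + 1} : Finset (Fin 5)) ∧
      (i = a ∨ i = a + 1) ∧ (j = b ∨ j = b + 1) := by
    revert i j; decide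
  obtain ⟨a, b, hd, hi, hj⟩ := this
  have hh := h a b hd
  rw [eq_empty_iff_forall_notMem] at hh ⊢
  rintro z ⟨hz1, hz2⟩
  refine hh z ⟨subset_convexHull ℝ _ ?_, subset_convexHull ℝ _ ?_⟩
  · rcases hi with rfl | rfl
    · exact Or.inl hz1
    · exact Or.inr hz1
  · rcases hj with rfl | rfl
    · exact Or.inl hz2
    · exact Or.inr hz2

theorem mk_c5 (G : Fin 5 → Set Plane) (hne : ∀ i, (G i).Nonempty)
    (h : ∀ i : Fin 5, convexHull ℝ (G i ∪ G (i + 1)) ∩ convexHull ℝ (G (i + 2) ∪ G (i + 3)) = ∅) :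
    IsCk 5 G := by
  have h' : ∀ i j : Fin 5, Disjoint ({i, i + 1} : Finset (Fin 5)) ({j, j + 1} : Finset (Fin 5)) →
    convexHull ℝ (G i ∪ G (i + 1)) ∩ convexHull ℝ (G j ∪ G (j + 1)) = ∅ := by
    intro i j hd
    have : j = i + 2 ∨ i = j + 2 := by revert i j; decide
    rcases this with rfl | rfl
    · have := h i
      rwa [show i + 3 = i + 2 + 1 by rw [add_assoc]; rfl] at this
    · have := h j
      rw [inter_comm]
      rwa [show j + 3 = j + 2 + 1 by rw [add_assoc]; rfl] at this
  refine ⟨?_, h'⟩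
  intro i j hij
  by_contra hne'
  have := hull_disj h' hne'
  rw [hij, inter_self] at this
  exact (hne j).ne_empty this

theorem sgn_R_lt {p q m : ℝ} {z : Plane} (h : p < z 0) (hs : sl p q z < m) :
    -m * z 0 + 1 * z 1 + (m * p - q) < 0 := by
  rw [sl, div_lt_iff₀ (by linarith)] at hs; linarith

theorem sgn_R_gt {p q m : ℝ} {z : Plane} (h : p < z 0) (hs : m < sl p q z) :
    0 < -m * z 0 + 1 * z 1 + (m * p - q) := by
  rw [sl, lt_div_iff₀ (by linarith)] at hs; linarith

theorem sgn_L_lt {p q m : ℝ} {z : Plane} (h : z 0 < p) (hs : sl p q z < m) :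
    0 < -m * z 0 + 1 * z 1 + (m * p - q) := by
  rw [sl, div_lt_iff_of_neg (by linarith)] at hs; linarith

theorem sgn_L_gt {p q m : ℝ} {z : Plane} (h : z 0 < p) (hs : m < sl p q z) :
    -m * z 0 + 1 * z 1 + (m * p - q) < 0 := by
  rw [sl, lt_div_iff_of_neg (by linarith)] at hs; linarith

theorem five_sectors {F : Set (Set Plane)} {LR LL HR HL M : Set Plane} {p q μ ν : ℝ} {s : Bool}
    (hμ : μ < ν) (nLR : LR.Nonempty) (nLL : LL.Nonempty) (nHR : HR.Nonempty) (nHL : HL.Nonempty)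
    (nM : M.Nonempty)
    (fLR : LR ∈ F) (fLL : LL ∈ F) (fHR : HR ∈ F) (fHL : HL ∈ F) (fM : M ∈ F)
    (sLR : Sd true p LR) (sLL : Sd false p LL) (sHR : Sd true p HR) (sHL : Sd false p HL)
    (sM : Sd s p M)
    (mLR : ∀ z ∈ LR, sl p q z < μ) (mLL : ∀ z ∈ LL, sl p q z < μ)
    (mHR : ∀ z ∈ HR, ν < sl p q z) (mHL : ∀ z ∈ HL, ν < sl p q z)
    (mM : ∀ z ∈ M, μ < sl p q z) (mM' : ∀ z ∈ M, sl p q z < ν) :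
    ∃ G : Fin 5 → Set Plane, (∀ i, G i ∈ F) ∧ IsCk 5 G := by
  simp only [Sd, if_true, if_false, Bool.false_eq_true] at sLR sLL sHR sHL
  have v1 : ∀ z ∈ LR, 0 < 1 * z 0 + 0 * z 1 + (-p) := fun z hz => by have := sLR z hz; linarith
  have v2 : ∀ z ∈ LL, 1 * z 0 + 0 * z 1 + (-p) < 0 := fun z hz => by have := sLL z hz; linarith
  have v3 : ∀ z ∈ HR, 0 < 1 * z 0 + 0 * z 1 + (-p) := fun z hz => by have := sHR z hz; linarith
  have v4 : ∀ z ∈ HL, 1 * z 0 + 0 * z 1 + (-p) < 0 := fun z hz => by have := sHL z hz; linarith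
  have a1 : ∀ z ∈ LR, -μ * z 0 + 1 * z 1 + (μ * p - q) < 0 :=
    fun z hz => sgn_R_lt (sLR z hz) (mLR z hz)
  have b1 : ∀ z ∈ LR, -ν * z 0 + 1 * z 1 + (ν * p - q) < 0 :=
    fun z hz => sgn_R_lt (sLR z hz) ((mLR z hz).trans hμ)
  have a2 : ∀ z ∈ LL, 0 < -μ * z 0 + 1 * z 1 + (μ * p - q) :=
    fun z hz => sgn_L_lt (sLL z hz) (mLL z hz)
  have b2 : ∀ z ∈ LL, 0 < -ν * z 0 + 1 * z 1 + (ν * p - q) :=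
    fun z hz => sgn_L_lt (sLL z hz) ((mLL z hz).trans hμ)
  have a3 : ∀ z ∈ HR, 0 < -μ * z 0 + 1 * z 1 + (μ * p - q) :=
    fun z hz => sgn_R_gt (sHR z hz) (hμ.trans (mHR z hz))
  have b3 : ∀ z ∈ HR, 0 < -ν * z 0 + 1 * z 1 + (ν * p - q) :=
    fun z hz => sgn_R_gt (sHR z hz) (mHR z hz)
  have a4 : ∀ z ∈ HL, -μ * z 0 + 1 * z 1 + (μ * p - q) < 0 :=
    fun z hz => sgn_L_gt (sHL z hz) (hμ.trans (mHL z hz))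
  have b4 : ∀ z ∈ HL, -ν * z 0 + 1 * z 1 + (ν * p - q) < 0 :=
    fun z hz => sgn_L_gt (sHL z hz) (mHL z hz)
  cases s
  · simp only [Sd, if_false, Bool.false_eq_true] at sM
    have v5 : ∀ z ∈ M, 1 * z 0 + 0 * z 1 + (-p) < 0 := fun z hz => by have := sM z hz; linarith
    have a5 : ∀ z ∈ M, -μ * z 0 + 1 * z 1 + (μ * p - q) < 0 :=
      fun z hz => sgn_L_gt (sM z hz) (mM z hz)
    have b5 : ∀ z ∈ M, 0 < -ν * z 0 + 1 * z 1 + (ν * p - q) :=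
      fun z hz => sgn_L_lt (sM z hz) (mM' z hz)
    refine ⟨![LL, M, HL, LR, HR], ?_, mk_c5 _ ?_ ?_⟩
    · intro i; fin_cases i <;> assumption
    · intro i; fin_cases i <;> assumption
    · intro i
      fin_cases i
      · change convexHull ℝ (LL ∪ M) ∩ convexHull ℝ (HL ∪ LR) = ∅
        rw [inter_comm]; exact sep_hull _ _ _ b4 b1 b2 b5
      · change convexHull ℝ (M ∪ HL) ∩ convexHull ℝ (LR ∪ HR) = ∅
        exact sep_hull _ _ _ v5 v4 v1 v3
      · change convexHull ℝ (HL ∪ LR) ∩ convexHull ℝ (HR ∪ LL) = ∅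
        exact sep_hull _ _ _ a4 a1 a3 a2
      · change convexHull ℝ (LR ∪ HR) ∩ convexHull ℝ (LL ∪ M) = ∅
        rw [inter_comm]; exact sep_hull _ _ _ v2 v5 v1 v3
      · change convexHull ℝ (HR ∪ LL) ∩ convexHull ℝ (M ∪ HL) = ∅
        rw [inter_comm]; exact sep_hull _ _ _ a5 a4 a3 a2
  · simp only [Sd, if_true] at sM
    have v5 : ∀ z ∈ M, 0 < 1 * z 0 + 0 * z 1 + (-p) := fun z hz => by have := sM z hz; linarith
    have a5 : ∀ z ∈ M, 0 < -μ * z 0 + 1 * z 1 + (μ * p - q) :=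
      fun z hz => sgn_R_gt (sM z hz) (mM z hz)
    have b5 : ∀ z ∈ M, -ν * z 0 + 1 * z 1 + (ν * p - q) < 0 :=
      fun z hz => sgn_R_lt (sM z hz) (mM' z hz)
    refine ⟨![LR, M, HR, LL, HL], ?_, mk_c5 _ ?_ ?_⟩
    · intro i; fin_cases i <;> assumption
    · intro i; fin_cases i <;> assumption
    · intro i
      fin_cases i
      · change convexHull ℝ (LR ∪ M) ∩ convexHull ℝ (HR ∪ LL) = ∅
        exact sep_hull _ _ _ b1 b5 b3 b2
      · change convexHull ℝ (M ∪ HR) ∩ convexHull ℝ (LL ∪ HL) = ∅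
        rw [inter_comm]; exact sep_hull _ _ _ v2 v4 v5 v3
      · change convexHull ℝ (HR ∪ LL) ∩ convexHull ℝ (HL ∪ LR) = ∅
        rw [inter_comm]; exact sep_hull _ _ _ a4 a1 a3 a2
      · change convexHull ℝ (LL ∪ HL) ∩ convexHull ℝ (LR ∪ M) = ∅
        exact sep_hull _ _ _ v2 v4 v1 v5
      · change convexHull ℝ (HL ∪ LR) ∩ convexHull ℝ (M ∪ HR) = ∅
        exact sep_hull _ _ _ a4 a1 a5 a3

def Low (F : Set (Set Plane)) (s : Bool) (p q : ℝ) : Prop :=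
  ∃ T ∈ F, Sd s p T ∧ ∀ S ∈ F, Sd (!s) p S → bt T p q ≤ bt S p q

def High (F : Set (Set Plane)) (s : Bool) (p q : ℝ) : Prop :=
  ∃ T ∈ F, Sd s p T ∧ ∀ S ∈ F, Sd (!s) p S → ab S p q ≤ ab T p q

/-- `F` is not pierced by a vertical line and two further lines through a common point. -/
def NoP (F : Set (Set Plane)) : Prop := ∀ p q m n : ℝ, ∃ S ∈ F, (¬ ∃ z ∈ S, z 0 = p) ∧
  (¬ ∃ z ∈ S, z 1 - q = m * (z 0 - p)) ∧ (¬ ∃ z ∈ S, z 1 - q = n * (z 0 - p))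

theorem sep_main {F : Set (Set Plane)} (hfin : F.Finite) (hF : ∀ S ∈ F, Good S)
    (hfree : ¬ ∃ G : Fin 5 → Set Plane, (∀ i, G i ∈ F) ∧ IsCk 5 G) (hno : NoP F)
    {s r : Bool} (p q : ℝ) (hL : Low F s p q) (hH : High F r p q) :
    ∃ ε > 0, ∀ p' q', |p' - p| < ε → |q' - q| < ε → ¬ (Low F (!s) p' q' ∧ High F (!r) p' q') := by
  obtain ⟨T0, ⟨hT0F, hT0s⟩, hT0⟩ := Set.exists_min_image {S | S ∈ F ∧ Sd s p S}
    (fun S => bt S p q) (hfin.subset fun S h => h.1) (by obtain ⟨T, h1, h2, _⟩ := hL; exact ⟨T, h1, h2⟩)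
  obtain ⟨T1, ⟨hT1F, hT1s⟩, hT1⟩ := Set.exists_max_image {S | S ∈ F ∧ Sd r p S}
    (fun S => ab S p q) (hfin.subset fun S h => h.1) (by obtain ⟨T, h1, h2, _⟩ := hH; exact ⟨T, h1, h2⟩)
  have lowmin : ∀ S ∈ F, ∀ t, Sd t p S → bt T0 p q ≤ bt S p q := by
    intro S hS t ht
    by_cases hts : t = s
    · subst hts; exact hT0 S ⟨hS, ht⟩
    · have : t = !s := by cases t <;> cases s <;> simp_all
      subst this
      obtain ⟨T, h1, h2, h3⟩ := hL
      exact (hT0 T ⟨h1, h2⟩).trans (h3 S hS ht)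
  have highmax : ∀ S ∈ F, ∀ t, Sd t p S → ab S p q ≤ ab T1 p q := by
    intro S hS t ht
    by_cases hts : t = r
    · subst hts; exact hT1 S ⟨hS, ht⟩
    · have : t = !r := by cases t <;> cases r <;> simp_all
      subst this
      obtain ⟨T, h1, h2, h3⟩ := hH
      exact (h3 S hS ht).trans (hT1 T ⟨h1, h2⟩)
  obtain ⟨M, hMF, hMv, hM1, hM2⟩ := hno p q (bt T0 p q) (ab T1 p q)
  obtain ⟨t, hMt⟩ := sd_or (hF M hMF) hMv
  have gM := hF M hMF
  have gap1 : bt T0 p q < ab M p q := by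
    by_contra h
    exact hM1 (sl_mid gM hMt (not_lt.mp h) (lowmin M hMF t hMt))
  have gap2 : bt M p q < ab T1 p q := by
    by_contra h
    exact hM2 (sl_mid gM hMt (highmax M hMF t hMt) (not_lt.mp h))
  obtain ⟨μ, hμ1, hμ2⟩ := exists_between gap1
  obtain ⟨ν, hν1, hν2⟩ := exists_between gap2
  have hμν : μ < ν := by have := ab_le_bt (q := q) gM hMt; linarith
  have ev : ∀ᶠ w : ℝ × ℝ in nhds (p, q), ¬ (Low F (!s) w.1 w.2 ∧ High F (!r) w.1 w.2) := by
    filter_upwards [open_sd (q := q) (hF _ hT0F) hT0s, open_sd (q := q) (hF _ hT1F) hT1s,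
      open_sd (q := q) gM hMt, open_bt (hF _ hT0F) hT0s hμ1, open_ab (hF _ hT1F) hT1s hν2,
      open_ab gM hMt hμ2, open_bt gM hMt hν1] with w e1 e2 e3 e4 e5 e6 e7
    rintro ⟨⟨S0, f0, s0, h0⟩, ⟨S1, f1, s1, h1⟩⟩
    have k0 : ∀ z ∈ S0, sl w.1 w.2 z < μ := by
      rw [← bt_lt_iff (hF _ f0) s0]
      refine lt_of_le_of_lt (h0 T0 hT0F (by simpa using e1)) ?_
      rwa [bt_lt_iff (hF _ hT0F) e1]
    have k1 : ∀ z ∈ S1, ν < sl w.1 w.2 z := by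
      rw [← lt_ab_iff (hF _ f1) s1]
      refine lt_of_lt_of_le ?_ (h1 T1 hT1F (by simpa using e2))
      rwa [lt_ab_iff (hF _ hT1F) e2]
    apply hfree
    cases s <;> cases r
    · exact five_sectors hμν (hF _ f0).1 (hF _ hT0F).1 (hF _ f1).1 (hF _ hT1F).1 gM.1
        f0 hT0F f1 hT1F hMF s0 e1 s1 e2 e3 k0 e4 k1 e5 e6 e7
    · exact five_sectors hμν (hF _ f0).1 (hF _ hT0F).1 (hF _ hT1F).1 (hF _ f1).1 gM.1
        f0 hT0F hT1F f1 hMF s0 e1 e2 s1 e3 k0 e4 e5 k1 e6 e7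
    · exact five_sectors hμν (hF _ hT0F).1 (hF _ f0).1 (hF _ f1).1 (hF _ hT1F).1 gM.1
        hT0F f0 f1 hT1F hMF e1 s0 s1 e2 e3 e4 k0 k1 e5 e6 e7
    · exact five_sectors hμν (hF _ hT0F).1 (hF _ f0).1 (hF _ hT1F).1 (hF _ f1).1 gM.1
        hT0F f0 hT1F f1 hMF e1 s0 e2 s1 e3 e4 k0 e5 k1 e6 e7
  rw [Metric.eventually_nhds_iff] at ev
  obtain ⟨ε, hε, h⟩ := ev
  refine ⟨ε, hε, fun p' q' hp hq => h (y := (p', q')) ?_⟩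
  rw [Prod.dist_eq, max_lt_iff, Real.dist_eq, Real.dist_eq]
  exact ⟨hp, hq⟩

theorem fin_no {F : Set (Set Plane)} (hfin : F.Finite) (hF : ∀ S ∈ F, Good S)
    (hfree : ¬ ∃ G : Fin 5 → Set Plane, (∀ i, G i ∈ F) ∧ IsCk 5 G) : ¬ NoP F := by
  intro hno
  have off : ∀ p, ∃ S ∈ F, ∃ s, Sd s p S := by
    intro p
    obtain ⟨S, hS, h, -⟩ := hno p 0 0 0
    exact ⟨S, hS, sd_or (hF S hS) h⟩
  obtain ⟨Y, hY, hbd⟩ : ∃ Y : ℝ, 0 < Y ∧ ∀ S ∈ F, ∀ z ∈ S, |z 0| < Y ∧ |z 1| < Y := by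
    have hc : IsCompact (⋃ S ∈ F, S) := hfin.isCompact_biUnion fun S hS => (hF S hS).2.1
    obtain ⟨a, ha⟩ := hc.exists_bound_of_continuousOn cont0.continuousOn
    obtain ⟨b, hb⟩ := hc.exists_bound_of_continuousOn cont1.continuousOn
    refine ⟨max (max a b) 0 + 1, by positivity, fun S hS z hz => ?_⟩
    have h1 := ha z (mem_biUnion hS hz)
    have h2 := hb z (mem_biUnion hS hz)
    rw [Real.norm_eq_abs] at h1 h2
    have := le_max_left (max a b) 0
    have := le_max_left a b
    have := le_max_right a b
    constructor <;> linarith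
  have emptyside : ∀ s p, (∀ S ∈ F, ¬ Sd s p S) → ∀ q, Low F (!s) p q ∧ High F (!s) p q := by
    intro s p h q
    obtain ⟨S, hS, t, ht⟩ := off p
    have : t = !s := by
      by_contra hh
      have : t = s := by cases t <;> cases s <;> simp_all
      exact h S hS (this ▸ ht)
    subst this
    exact ⟨⟨S, hS, ht, fun T hT hT' => absurd (by simpa using hT') (h T hT)⟩,
      ⟨S, hS, ht, fun T hT hT' => absurd (by simpa using hT') (h T hT)⟩⟩
  have lowor : ∀ p q, Low F true p q ∨ Low F false p q := by
    intro p q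
    obtain ⟨T, ⟨hT, t, ht⟩, hmin⟩ := Set.exists_min_image {S | S ∈ F ∧ ∃ s, Sd s p S}
      (fun S => bt S p q) (hfin.subset fun S h => h.1)
      (by obtain ⟨T, h1, h2⟩ := off p; exact ⟨T, h1, h2⟩)
    have : Low F t p q := ⟨T, hT, ht, fun S hS hS' => hmin S ⟨hS, _, hS'⟩⟩
    cases t
    · exact Or.inr this
    · exact Or.inl this
  have highor : ∀ p q, High F true p q ∨ High F false p q := by
    intro p q
    obtain ⟨T, ⟨hT, t, ht⟩, hmin⟩ := Set.exists_max_image {S | S ∈ F ∧ ∃ s, Sd s p S}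
      (fun S => ab S p q) (hfin.subset fun S h => h.1)
      (by obtain ⟨T, h1, h2⟩ := off p; exact ⟨T, h1, h2⟩)
    have : High F t p q := ⟨T, hT, ht, fun S hS hS' => hmin S ⟨hS, _, hS'⟩⟩
    cases t
    · exact Or.inr this
    · exact Or.inl this
  refine topo_main (Low F true) (Low F false) (High F true) (High F false) Y hY lowor highor
    ?_ ?_ ?_ ?_
    (fun p q h1 h2 => sep_main hfin hF hfree hno p q h1 h2)
    (fun p q h1 h2 => sep_main hfin hF hfree hno p q h1 h2)
    (fun p q h1 h2 => sep_main hfin hF hfree hno p q h1 h2)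
    (fun p q h1 h2 => sep_main hfin hF hfree hno p q h1 h2) ?_ ?_ ?_
  · rintro p q q' hq ⟨T, hT, hs, h⟩
    exact ⟨T, hT, hs, fun S hS hS' => (bt_right (hF T hT) hs hq).trans
      ((h S hS hS').trans (bt_left (hF S hS) hS' hq))⟩
  · rintro p q q' hq ⟨T, hT, hs, h⟩
    exact ⟨T, hT, hs, fun S hS hS' => (ab_right (hF S hS) hS' hq).trans
      ((h S hS hS').trans (ab_left (hF T hT) hs hq))⟩
  · rintro p q q' hq ⟨T, hT, hs, h⟩
    exact ⟨T, hT, hs, fun S hS hS' => (bt_left (hF T hT) hs hq).trans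
      ((h S hS hS').trans (bt_right (hF S hS) hS' hq))⟩
  · rintro p q q' hq ⟨T, hT, hs, h⟩
    exact ⟨T, hT, hs, fun S hS hS' => (ab_left (hF S hS) hS' hq).trans
      ((h S hS hS').trans (ab_right (hF T hT) hs hq))⟩
  · intro p
    by_cases hl : ∀ S ∈ F, ¬ Sd false p S
    · exact Or.inl (emptyside false p hl)
    by_cases hr : ∀ S ∈ F, ¬ Sd true p S
    · exact Or.inr (Or.inl (emptyside true p hr))
    push Not at hl hr
    obtain ⟨L, hLF, hL⟩ := hl
    obtain ⟨R, hRF, hR⟩ := hr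
    have rt : ∀ S ∈ F, Sd true p S → ∀ z ∈ S, sl p Y z < 0 := by
      intro S hS h z hz
      have h1 : p < z 0 := by simpa [Sd] using h z hz
      have := abs_lt.mp (hbd S hS z hz).2
      exact div_neg_of_neg_of_pos (by linarith) (by linarith)
    have rb : ∀ S ∈ F, Sd true p S → ∀ z ∈ S, 0 < sl p (-Y) z := by
      intro S hS h z hz
      have h1 : p < z 0 := by simpa [Sd] using h z hz
      have := abs_lt.mp (hbd S hS z hz).2
      exact div_pos (by linarith) (by linarith)
    have lt' : ∀ S ∈ F, Sd false p S → ∀ z ∈ S, 0 < sl p Y z := by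
      intro S hS h z hz
      have h1 : z 0 < p := by simpa [Sd] using h z hz
      have := abs_lt.mp (hbd S hS z hz).2
      exact div_pos_of_neg_of_neg (by linarith) (by linarith)
    have lb : ∀ S ∈ F, Sd false p S → ∀ z ∈ S, sl p (-Y) z < 0 := by
      intro S hS h z hz
      have h1 : z 0 < p := by simpa [Sd] using h z hz
      have := abs_lt.mp (hbd S hS z hz).2
      exact div_neg_of_pos_of_neg (by linarith) (by linarith)
    refine Or.inr (Or.inr ⟨⟨⟨R, hRF, hR, fun S hS h => ?_⟩, ⟨L, hLF, hL, fun S hS h => ?_⟩⟩,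
      ⟨⟨L, hLF, hL, fun S hS h => ?_⟩, ⟨R, hRF, hR, fun S hS h => ?_⟩⟩⟩)
    · have h1 := (bt_lt_iff (hF R hRF) hR).mpr (rt R hRF hR)
      have h2 := (lt_ab_iff (hF S hS) h).mpr (lt' S hS h)
      have h3 := ab_le_bt (q := Y) (hF S hS) h
      linarith
    · have h1 := (bt_lt_iff (hF S hS) h).mpr (rt S hS h)
      have h2 := (lt_ab_iff (hF L hLF) hL).mpr (lt' L hLF hL)
      have h3 := ab_le_bt (q := Y) (hF S hS) h
      linarith
    · have h1 := (bt_lt_iff (hF L hLF) hL).mpr (lb L hLF hL)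
      have h2 := (lt_ab_iff (hF S hS) h).mpr (rb S hS h)
      have h3 := ab_le_bt (q := -Y) (hF S hS) h
      linarith
    · have h1 := (bt_lt_iff (hF S hS) h).mpr (lb S hS h)
      have h2 := (lt_ab_iff (hF R hRF) hR).mpr (rb R hRF hR)
      have h3 := ab_le_bt (q := -Y) (hF S hS) h
      linarith
  · refine ⟨-Y, emptyside false _ fun S hS h => ?_⟩
    obtain ⟨z, hz⟩ := (hF S hS).1
    have h1 : z 0 < -Y := by simpa [Sd] using h z hz
    have := abs_lt.mp (hbd S hS z hz).1
    linarith
  · refine ⟨Y, emptyside true _ fun S hS h => ?_⟩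
    obtain ⟨z, hz⟩ := (hF S hS).1
    have h1 : Y < z 0 := by simpa [Sd] using h z hz
    have := abs_lt.mp (hbd S hS z hz).1
    linarith

/-- pierced by the (possibly degenerate) line with homogeneous coordinates `u` -/
def Hits (u : Fin 3 → ℝ) (S : Set Plane) : Prop := ∃ z ∈ S, u 0 * z 0 + u 1 * z 1 + u 2 = 0

theorem hits_closed (S : Set Plane) (hS : IsCompact S) (i : Fin 3) :
    IsClosed {w : Fin 3 → Fin 3 → ℝ | Hits (w i) S} := by
  rw [← isOpen_compl_iff, isOpen_iff_mem_nhds]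
  intro w hw
  have hw' : ∀ z ∈ S, w i 0 * z 0 + w i 1 * z 1 + w i 2 ≠ 0 := fun z hz h => hw ⟨z, hz, h⟩
  have : ∀ᶠ v : Fin 3 → Fin 3 → ℝ in nhds w, ∀ z ∈ S,
      v i 0 * z 0 + v i 1 * z 1 + v i 2 ≠ 0 := by
    refine hS.eventually_forall_of_forall_eventually
      (P := fun (v : Fin 3 → Fin 3 → ℝ) (z : Plane) => v i 0 * z 0 + v i 1 * z 1 + v i 2 ≠ 0) ?_
    intro z hz
    have hc : Continuous fun u : (Fin 3 → Fin 3 → ℝ) × Plane =>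
      u.1 i 0 * u.2 0 + u.1 i 1 * u.2 1 + u.1 i 2 := by fun_prop
    exact hc.continuousAt.eventually_ne (hw' z hz)
  filter_upwards [this] with v hv
  rintro ⟨z, hz, h⟩
  exact hv z hz h

theorem hits_smul {u : Fin 3 → ℝ} {S : Set Plane} (c : ℝ) (h : Hits u S) : Hits (c • u) S := by
  obtain ⟨z, hz, h⟩ := h
  refine ⟨z, hz, ?_⟩
  simp only [Pi.smul_apply, smul_eq_mul]
  linear_combination c * h

theorem fin_hits {F : Set (Set Plane)} (hfin : F.Finite) (hF : ∀ S ∈ F, Good S)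
    (hfree : ¬ ∃ G : Fin 5 → Set Plane, (∀ i, G i ∈ F) ∧ IsCk 5 G) :
    ∃ w ∈ Set.pi univ (fun _ : Fin 3 => Metric.sphere (0 : Fin 3 → ℝ) 1),
      ∀ S ∈ F, ∃ i, Hits (w i) S := by
  have h := fin_no hfin hF hfree
  unfold NoP at h
  push Not at h
  obtain ⟨p, q, m, n, h⟩ := h
  set u : Fin 3 → Fin 3 → ℝ := ![![1, 0, -p], ![-m, 1, m * p - q], ![-n, 1, n * p - q]] with hu
  have hne : ∀ i, u i ≠ 0 := by
    intro i hi
    fin_cases i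
    · have := congrFun hi 0
      simp [hu] at this
    · have := congrFun hi 1
      simp [hu] at this
    · have := congrFun hi 1
      simp [hu] at this
  refine ⟨fun i => ‖u i‖⁻¹ • u i, ?_, ?_⟩
  · intro i _
    rw [mem_sphere_zero_iff_norm, norm_smul, norm_inv, norm_norm,
      inv_mul_cancel₀ (norm_ne_zero_iff.mpr (hne i))]
  · intro S hS
    have : ∃ i, Hits (u i) S := by
      by_cases h1 : ∃ z ∈ S, z 0 = p
      · obtain ⟨z, hz, e⟩ := h1
        exact ⟨0, z, hz, by simp [hu, e]⟩
      by_cases h2 : ∃ z ∈ S, z 1 - q = m * (z 0 - p)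
      · obtain ⟨z, hz, e⟩ := h2
        refine ⟨1, z, hz, ?_⟩
        simp [hu]; linarith
      push Not at h1 h2
      obtain ⟨z, hz, e⟩ := h S hS h1 h2
      refine ⟨2, z, hz, ?_⟩
      simp [hu]; linarith
    obtain ⟨i, hi⟩ := this
    exact ⟨i, hits_smul _ hi⟩

theorem exists_line (u : Fin 3 → ℝ) (hu : u ≠ 0) :
    ∃ L : Set Plane, IsLine L ∧ ∀ S, Hits u S → (S ∩ L).Nonempty := by
  by_cases h : u 0 = 0 ∧ u 1 = 0
  · refine ⟨_, ⟨0, !₂[1, 0], ?_, rfl⟩, ?_⟩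
    · intro h
      have := congrArg (fun z : Plane => z 0) h
      simp at this
    · rintro S ⟨z, hz, e⟩
      exfalso
      apply hu
      rw [h.1, h.2] at e
      ext i
      fin_cases i
      · exact h.1
      · exact h.2
      · simpa using e
  · have hpos : u 0 ^ 2 + u 1 ^ 2 ≠ 0 := by
      intro h0
      apply h
      constructor <;> nlinarith [sq_nonneg (u 0), sq_nonneg (u 1)]
    set d := u 0 ^ 2 + u 1 ^ 2 with hd
    refine ⟨_, ⟨!₂[-u 2 * u 0 / d, -u 2 * u 1 / d], !₂[-u 1, u 0], ?_, rfl⟩, ?_⟩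
    · intro h'
      have h0 := congrArg (fun z : Plane => z 0) h'
      have h1 := congrArg (fun z : Plane => z 1) h'
      simp at h0 h1
      exact h ⟨h1, h0⟩
    · rintro S ⟨z, hz, e⟩
      refine ⟨z, hz, (u 0 * z 1 - u 1 * z 0) / d, ?_⟩
      ext i
      fin_cases i
      · simp
        field_simp
        rw [hd]
        linear_combination u 0 * e
      · simp
        field_simp
        rw [hd]
        linear_combination u 1 * e

theorem upper (F : Set (Set Plane))
    (hF : ∀ S ∈ F, S.Nonempty ∧ IsCompact S ∧ Convex ℝ S)
    (hfree : ¬ ∃ G : Fin 5 → Set Plane, (∀ i, G i ∈ F) ∧ IsCk 5 G) :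
    ∃ L : Fin 3 → Set Plane, (∀ i, IsLine (L i)) ∧ ∀ S ∈ F, ∃ i, (S ∩ L i).Nonempty := by
  have hK : IsCompact (Set.pi univ (fun _ : Fin 3 => Metric.sphere (0 : Fin 3 → ℝ) 1)) :=
    isCompact_univ_pi fun _ => isCompact_sphere _ _
  obtain ⟨w, hwK, hw⟩ := hK.inter_iInter_nonempty
    (fun S : F => {w : Fin 3 → Fin 3 → ℝ | ∃ i, Hits (w i) S.1})
    (fun S => by
      have : {w : Fin 3 → Fin 3 → ℝ | ∃ i, Hits (w i) S.1} =
        ⋃ i, {w : Fin 3 → Fin 3 → ℝ | Hits (w i) S.1} := by ext; simp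
      rw [this]
      exact isClosed_iUnion_of_finite fun i => hits_closed S.1 (hF S.1 S.2).2.1 i)
    (fun t => by
      have hsub : ∀ S ∈ ((fun S : F => S.1) '' (t : Set F)), S ∈ F := by
        rintro _ ⟨S, -, rfl⟩; exact S.2
      obtain ⟨w, hw1, hw2⟩ := fin_hits (F := (fun S : F => S.1) '' (t : Set F))
        (t.finite_toSet.image _) (fun S hS => hF S (hsub S hS))
        (fun ⟨G, hG, hG'⟩ => hfree ⟨G, fun i => hsub _ (hG i), hG'⟩)
      refine ⟨w, hw1, ?_⟩
      simp only [mem_iInter]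
      intro S hS
      exact hw2 S.1 ⟨S, hS, rfl⟩)
  have hne : ∀ i, w i ≠ 0 := by
    intro i h
    have := hwK i (mem_univ i)
    rw [h] at this
    simp at this
  choose L hL hL' using fun i => exists_line (w i) (hne i)
  refine ⟨L, hL, fun S hS => ?_⟩
  obtain ⟨i, hi⟩ := mem_iInter.mp hw ⟨S, hS⟩
  exact ⟨i, hL' i S hi⟩

theorem quad_two {a b c r s : ℝ} (hne : ¬ (a = 0 ∧ b = 0)) (hrs : r ≠ s)
    (hr : a * r ^ 2 + b * r + c = 0) (hs : a * s ^ 2 + b * s + c = 0)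
    (r0 : 0 < r) (r8 : r < 8) (s0 : 0 < s) (s8 : s < 8) :
    0 < (a * 8 ^ 2 + b * 8 + c) * (a * 0 ^ 2 + b * 0 + c) := by
  have hb : b = -a * (r + s) := by
    have : (r - s) * (a * (r + s) + b) = 0 := by linear_combination hr - hs
    rcases mul_eq_zero.mp this with h | h
    · exact absurd (sub_eq_zero.mp h) hrs
    · linarith
  have hc : c = a * r * s := by rw [hb] at hr; linear_combination hr
  have ha : a ≠ 0 := fun h => hne ⟨h, by rw [hb, h]; ring⟩
  have : (a * 8 ^ 2 + b * 8 + c) * (a * 0 ^ 2 + b * 0 + c)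
      = a ^ 2 * ((8 - r) * (8 - s) * (r * s)) := by rw [hc, hb]; ring
  rw [this]
  have h1 : 0 < 8 - r := by linarith
  have h2 : 0 < 8 - s := by linarith
  positivity

theorem quad_three {a b c r s t : ℝ} (hne : ¬ (a = 0 ∧ b = 0)) (hrs : r ≠ s) (hrt : r ≠ t)
    (hst : s ≠ t)
    (hr : a * r ^ 2 + b * r + c = 0) (hs : a * s ^ 2 + b * s + c = 0)
    (ht : a * t ^ 2 + b * t + c = 0) : False := by
  have h1 : a * (r + s) + b = 0 := by
    have : (r - s) * (a * (r + s) + b) = 0 := by linear_combination hr - hs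
    exact (mul_eq_zero.mp this).resolve_left (sub_ne_zero.mpr hrs)
  have h2 : a * (r + t) + b = 0 := by
    have : (r - t) * (a * (r + t) + b) = 0 := by linear_combination hr - ht
    exact (mul_eq_zero.mp this).resolve_left (sub_ne_zero.mpr hrt)
  have h3 : a = 0 := by
    have : (s - t) * a = 0 := by linear_combination h1 - h2
    exact (mul_eq_zero.mp this).resolve_left (sub_ne_zero.mpr hst)
  exact hne ⟨h3, by rw [h3] at h1; linarith⟩

theorem root_between {f : ℝ → ℝ} (hf : Continuous f) {x y : ℝ} (hxy : x ≤ y)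
    (h : f x * f y ≤ 0) : ∃ t, x ≤ t ∧ t ≤ y ∧ f t = 0 := by
  rcases mul_nonpos_iff.mp h with ⟨h1, h2⟩ | ⟨h1, h2⟩
  · obtain ⟨t, ht, e⟩ := intermediate_value_Icc' hxy hf.continuousOn (show (0:ℝ) ∈ Icc _ _ from ⟨h2, h1⟩)
    exact ⟨t, ht.1, ht.2, e⟩
  · obtain ⟨t, ht, e⟩ := intermediate_value_Icc hxy hf.continuousOn (show (0:ℝ) ∈ Icc _ _ from ⟨h1, h2⟩)
    exact ⟨t, ht.1, ht.2, e⟩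

open Polynomial in
theorem two_quads {a b c a' b' c' : ℝ} (h1 : ¬ (a = 0 ∧ b = 0)) (h2 : ¬ (a' = 0 ∧ b' = 0))
    (h : ∀ i : ℕ, i < 8 →
      (a * (i : ℝ) ^ 2 + b * i + c) * (a * ((i : ℝ) + 1) ^ 2 + b * ((i : ℝ) + 1) + c) ≤ 0 ∨
      (a' * (i : ℝ) ^ 2 + b' * i + c') * (a' * ((i : ℝ) + 1) ^ 2 + b' * ((i : ℝ) + 1) + c') ≤ 0)
    (h8 : (a * 8 ^ 2 + b * 8 + c) * (a * 0 ^ 2 + b * 0 + c) ≤ 0 ∨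
      (a' * 8 ^ 2 + b' * 8 + c') * (a' * 0 ^ 2 + b' * 0 + c') ≤ 0) : False := by
  set P : ℝ[X] := (C a * X ^ 2 + C b * X + C c) with hP
  set Q : ℝ[X] := (C a' * X ^ 2 + C b' * X + C c') with hQ
  have hP0 : P ≠ 0 := by
    intro h0
    apply h1
    have e2 := congrArg (fun p => p.coeff 2) h0
    have e1 := congrArg (fun p => p.coeff 1) h0
    simp [hP, coeff_X, coeff_C] at e1 e2
    exact ⟨e2, e1⟩
  have hQ0 : Q ≠ 0 := by
    intro h0
    apply h2
    have e2 := congrArg (fun p => p.coeff 2) h0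
    have e1 := congrArg (fun p => p.coeff 1) h0
    simp [hQ, coeff_X, coeff_C] at e1 e2
    exact ⟨e2, e1⟩
  have hPd : P.natDegree ≤ 2 := natDegree_quadratic_le
  have hQd : Q.natDegree ≤ 2 := natDegree_quadratic_le
  set R := (P * Q).roots.toFinset with hR
  have hRc : R.card ≤ 4 := by
    refine (Multiset.toFinset_card_le _).trans ((card_roots' _).trans (natDegree_mul_le.trans ?_))
    omega
  have hmem : ∀ t, t ∈ R ↔ (a * t ^ 2 + b * t + c = 0 ∨ a' * t ^ 2 + b' * t + c' = 0) := by
    intro t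
    rw [hR, Multiset.mem_toFinset, mem_roots (mul_ne_zero hP0 hQ0), IsRoot, eval_mul, mul_eq_zero]
    simp [hP, hQ]
  have hroot : ∀ i : ℕ, i < 8 → ∃ t ∈ R, (i : ℝ) ≤ t ∧ t ≤ i + 1 := by
    intro i hi
    rcases h i hi with h | h
    · obtain ⟨t, t1, t2, t3⟩ := root_between (f := fun t => a * t ^ 2 + b * t + c)
        (by fun_prop) (show (i : ℝ) ≤ i + 1 by linarith) h
      exact ⟨t, (hmem t).mpr (Or.inl t3), t1, t2⟩
    · obtain ⟨t, t1, t2, t3⟩ := root_between (f := fun t => a' * t ^ 2 + b' * t + c')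
        (by fun_prop) (show (i : ℝ) ≤ i + 1 by linarith) h
      exact ⟨t, (hmem t).mpr (Or.inr t3), t1, t2⟩
  obtain ⟨x0, m0, l0, u0⟩ := hroot 0 (by norm_num)
  obtain ⟨x1, m1, l1, u1⟩ := hroot 1 (by norm_num)
  obtain ⟨x2, m2, l2, u2⟩ := hroot 2 (by norm_num)
  obtain ⟨x3, m3, l3, u3⟩ := hroot 3 (by norm_num)
  obtain ⟨x4, m4, l4, u4⟩ := hroot 4 (by norm_num)
  obtain ⟨x5, m5, l5, u5⟩ := hroot 5 (by norm_num)
  obtain ⟨x6, m6, l6, u6⟩ := hroot 6 (by norm_num)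
  obtain ⟨x7, m7, l7, u7⟩ := hroot 7 (by norm_num)
  norm_num at l0 u0 l1 u1 l2 u2 l3 u3 l4 u4 l5 u5 l6 u6 l7 u7
  have hsub : ({x0, x2, x4, x6} : Finset ℝ) ⊆ R := by
    intro t ht
    simp only [Finset.mem_insert, Finset.mem_singleton] at ht
    rcases ht with rfl | rfl | rfl | rfl <;> assumption
  have hcard : ({x0, x2, x4, x6} : Finset ℝ).card = 4 := by
    have n1 : x0 ≠ x2 := by intro h; linarith
    have n2 : x0 ≠ x4 := by intro h; linarith
    have n3 : x0 ≠ x6 := by intro h; linarith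
    have n4 : x2 ≠ x4 := by intro h; linarith
    have n5 : x2 ≠ x6 := by intro h; linarith
    have n6 : x4 ≠ x6 := by intro h; linarith
    simp [n1, n2, n3, n4, n5, n6]
  have hReq := Finset.eq_of_subset_of_card_le hsub (by rw [hcard]; exact hRc)
  have hin : ∀ t ∈ R, t = x0 ∨ t = x2 ∨ t = x4 ∨ t = x6 := by
    intro t ht
    rw [← hReq] at ht
    simpa using ht
  have e7 : x6 = 7 := by rcases hin x7 m7 with h | h | h | h <;> linarith
  have e5 : x4 = 5 := by rcases hin x5 m5 with h | h | h | h <;> linarith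
  have e3 : x2 = 3 := by rcases hin x3 m3 with h | h | h | h <;> linarith
  have e1 : x0 = 1 := by rcases hin x1 m1 with h | h | h | h <;> linarith
  subst e7 e5 e3 e1
  rw [hmem] at m0 m2 m4 m6
  have fin2 : ∀ r s t u : ℝ, r ≠ s → t ≠ u → 0 < r → r < 8 → 0 < s → s < 8 →
      0 < t → t < 8 → 0 < u → u < 8 → a * r ^ 2 + b * r + c = 0 → a * s ^ 2 + b * s + c = 0 →
      a' * t ^ 2 + b' * t + c' = 0 → a' * u ^ 2 + b' * u + c' = 0 → False := by
    intro r s t u n1 n2 r0 r8 s0 s8 t0 t8 u0 u8 hr hs ht hu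
    have k1 := quad_two h1 n1 hr hs r0 r8 s0 s8
    have k2 := quad_two h2 n2 ht hu t0 t8 u0 u8
    rcases h8 with h | h <;> linarith
  have q1 := fun r s t hrs hrt hst => quad_three (c := c) (r := r) (s := s) (t := t) h1 hrs hrt hst
  have q2 := fun r s t hrs hrt hst => quad_three (c := c') (r := r) (s := s) (t := t) h2 hrs hrt hst
  rcases m0 with m0 | m0 <;> rcases m2 with m2 | m2 <;> rcases m4 with m4 | m4 <;>
    rcases m6 with m6 | m6
  · exact q1 1 3 5 (by norm_num) (by norm_num) (by norm_num) m0 m2 m4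
  · exact q1 1 3 5 (by norm_num) (by norm_num) (by norm_num) m0 m2 m4
  · exact q1 1 3 7 (by norm_num) (by norm_num) (by norm_num) m0 m2 m6
  · exact fin2 1 3 5 7 (by norm_num) (by norm_num) (by norm_num) (by norm_num) (by norm_num)
      (by norm_num) (by norm_num) (by norm_num) (by norm_num) (by norm_num) m0 m2 m4 m6
  · exact q1 1 5 7 (by norm_num) (by norm_num) (by norm_num) m0 m4 m6
  · exact fin2 1 5 3 7 (by norm_num) (by norm_num) (by norm_num) (by norm_num) (by norm_num)
      (by norm_num) (by norm_num) (by norm_num) (by norm_num) (by norm_num) m0 m4 m2 m6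
  · exact fin2 1 7 3 5 (by norm_num) (by norm_num) (by norm_num) (by norm_num) (by norm_num)
      (by norm_num) (by norm_num) (by norm_num) (by norm_num) (by norm_num) m0 m6 m2 m4
  · exact q2 3 5 7 (by norm_num) (by norm_num) (by norm_num) m2 m4 m6
  · exact q1 3 5 7 (by norm_num) (by norm_num) (by norm_num) m2 m4 m6
  · exact fin2 3 5 1 7 (by norm_num) (by norm_num) (by norm_num) (by norm_num) (by norm_num)
      (by norm_num) (by norm_num) (by norm_num) (by norm_num) (by norm_num) m2 m4 m0 m6
  · exact fin2 3 7 1 5 (by norm_num) (by norm_num) (by norm_num) (by norm_num) (by norm_num)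
      (by norm_num) (by norm_num) (by norm_num) (by norm_num) (by norm_num) m2 m6 m0 m4
  · exact q2 1 5 7 (by norm_num) (by norm_num) (by norm_num) m0 m4 m6
  · exact fin2 5 7 1 3 (by norm_num) (by norm_num) (by norm_num) (by norm_num) (by norm_num)
      (by norm_num) (by norm_num) (by norm_num) (by norm_num) (by norm_num) m4 m6 m0 m2
  · exact q2 1 3 7 (by norm_num) (by norm_num) (by norm_num) m0 m2 m6
  · exact q2 1 3 5 (by norm_num) (by norm_num) (by norm_num) m0 m2 m4
  · exact q2 1 3 5 (by norm_num) (by norm_num) (by norm_num) m0 m2 m4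

def vtx (i : Fin 9) : Plane := !₂[((i : ℕ) : ℝ), ((i : ℕ) : ℝ) ^ 2]

def side (i : Fin 9) : Set Plane := segment ℝ (vtx i) (vtx (i + 1))

theorem line_quad {L : Set Plane} (hL : IsLine L) : ∃ a b c : ℝ, ¬ (a = 0 ∧ b = 0) ∧
    ∀ i : Fin 9, (side i ∩ L).Nonempty →
      (a * ((i : ℕ) : ℝ) ^ 2 + b * ((i : ℕ) : ℝ) + c) *
      (a * (((i + 1 : Fin 9) : ℕ) : ℝ) ^ 2 + b * (((i + 1 : Fin 9) : ℕ) : ℝ) + c) ≤ 0 := by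
  obtain ⟨p, v, hv, rfl⟩ := hL
  refine ⟨-v 0, v 1, v 0 * p 1 - v 1 * p 0, ?_, ?_⟩
  · rintro ⟨h0, h1⟩
    apply hv
    ext i
    fin_cases i
    · simpa using h0
    · simpa using h1
  · rintro i ⟨z, ⟨s, t, hs, ht, hst, hz⟩, r, hr⟩
    have e0 := congrArg (fun z : Plane => z 0) hz
    have e1 := congrArg (fun z : Plane => z 1) hz
    have g0 := congrArg (fun z : Plane => z 0) hr
    have g1 := congrArg (fun z : Plane => z 1) hr
    simp only [vtx, PiLp.add_apply, PiLp.smul_apply, smul_eq_mul, PiLp.toLp_apply,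
      Matrix.cons_val_zero, Matrix.cons_val_one] at e0 e1 g0 g1
    set x : ℝ := ((i : ℕ) : ℝ)
    set y : ℝ := (((i + 1 : Fin 9) : ℕ) : ℝ)
    set f := -v 0 * x ^ 2 + v 1 * x + (v 0 * p 1 - v 1 * p 0) with hf
    set g := -v 0 * y ^ 2 + v 1 * y + (v 0 * p 1 - v 1 * p 0) with hg
    have key : s * f + t * g = 0 := by
      rw [hf, hg]
      linear_combination (-v 0) * e1 + v 1 * e0 + (-v 0) * g1 + v 1 * g0 +
        (v 0 * p 1 - v 1 * p 0) * hst
    by_contra! hpos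
    rcases mul_pos_iff.mp hpos with ⟨hf', hg'⟩ | ⟨hf', hg'⟩
    · rcases hs.eq_or_lt with rfl | hs'
      · have : t = 1 := by linarith
        subst this; linarith
      · nlinarith [mul_pos hs' hf', mul_nonneg ht hg'.le]
    · rcases hs.eq_or_lt with rfl | hs'
      · have : t = 1 := by linarith
        subst this; linarith
      · nlinarith [mul_neg_of_pos_of_neg hs' hf', mul_nonpos_of_nonneg_of_nonpos ht hg'.le]

theorem lower : ∃ F : Finset (Set Plane),
      (∀ S ∈ F, S.Nonempty ∧ IsCompact S ∧ Convex ℝ S) ∧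
      (¬ ∃ G : Fin 5 → Set Plane, (∀ i, G i ∈ (F : Set (Set Plane))) ∧ IsCk 5 G) ∧
      ¬ ∃ L : Fin 2 → Set Plane, (∀ i, IsLine (L i)) ∧
        ∀ S ∈ F, ∃ i, (S ∩ L i).Nonempty := by
  classical
  refine ⟨Finset.univ.image side, ?_, ?_, ?_⟩
  · intro S hS
    obtain ⟨i, -, rfl⟩ := Finset.mem_image.mp hS
    refine ⟨⟨_, left_mem_segment ℝ _ _⟩, ?_, convex_segment _ _⟩
    rw [side, segment_eq_image_lineMap]
    exact isCompact_Icc.image AffineMap.lineMap_continuous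
  · rintro ⟨G, hG, hinj, hk⟩
    have : ∀ i, ∃ j : Fin 9, side j = G i := by
      intro i
      have := hG i
      simpa using this
    choose c hc using this
    have hd : ∀ i j, i ≠ j → side (c i) ∩ side (c j) = ∅ := by
      intro i j hij
      rw [hc, hc]; exact hull_disj hk hij
    have d1 : ∀ i j, c i = c j → i = j := by
      intro i j h
      exact hinj (by rw [← hc, ← hc, h])
    have d2 : ∀ i j, c j ≠ c i + 1 := by
      intro i j h
      by_cases hij : i = j
      · subst hij
        generalize c i = x at h
        revert x; decide
      · have hh := hd i j hij
        rw [eq_empty_iff_forall_notMem] at hh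
        refine hh (vtx (c i + 1)) ⟨right_mem_segment ℝ _ _, ?_⟩
        rw [h]; exact left_mem_segment ℝ _ _
    have hinj' : Function.Injective fun x : Fin 5 × Bool => if x.2 then c x.1 else c x.1 + 1 := by
      rintro ⟨i, s⟩ ⟨j, t⟩ h
      cases s <;> cases t <;> simp at h
      · rw [d1 i j h]
      · exact absurd h.symm (d2 i j)
      · exact absurd h (d2 j i)
      · rw [d1 i j h]
    have := Fintype.card_le_of_injective _ hinj'
    simp at this
  · rintro ⟨L, hL, hp⟩
    obtain ⟨a, b, c, h1, k1⟩ := line_quad (hL 0)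
    obtain ⟨a', b', c', h2, k2⟩ := line_quad (hL 1)
    have hor : ∀ i : Fin 9, (side i ∩ L 0).Nonempty ∨ (side i ∩ L 1).Nonempty := by
      intro i
      obtain ⟨j, hj⟩ := hp (side i) (Finset.mem_image_of_mem _ (Finset.mem_univ i))
      fin_cases j
      · exact Or.inl hj
      · exact Or.inr hj
    refine two_quads (c := c) (c' := c') h1 h2 (fun i hi => ?_) ?_
    · have hval : (((⟨i, by omega⟩ : Fin 9) + 1 : Fin 9) : ℕ) = i + 1 := by
        rw [Fin.val_add]; simp; omega
      refine (hor ⟨i, by omega⟩).imp (fun h => ?_) (fun h => ?_)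
      · have := k1 _ h
        rw [hval] at this
        push_cast at this
        exact this
      · have := k2 _ h
        rw [hval] at this
        push_cast at this
        exact this
    · have hval : (((8 : Fin 9) + 1 : Fin 9) : ℕ) = 0 := rfl
      have hval' : ((8 : Fin 9) : ℕ) = 8 := rfl
      refine (hor 8).imp (fun h => ?_) (fun h => ?_)
      · have := k1 _ h
        rw [hval, hval'] at this
        push_cast at this
        exact this
      · have := k2 _ h
        rw [hval, hval'] at this
        push_cast at this
        exact this

/-- L(5) = 3. Every C(5)-free family of nonempty compact convex sets
can be pierced by 3 lines, and some C(5)-free family of nonempty compact convex sets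
cannot be pierced by 2 lines. -/
theorem L_five_eq_three :
    (∀ F : Set (Set Plane),
      (∀ S ∈ F, S.Nonempty ∧ IsCompact S ∧ Convex ℝ S) →
      (¬ ∃ G : Fin 5 → Set Plane, (∀ i, G i ∈ F) ∧ IsCk 5 G) →
      ∃ L : Fin 3 → Set Plane, (∀ i, IsLine (L i)) ∧
        ∀ S ∈ F, ∃ i, (S ∩ L i).Nonempty) ∧
    (∃ F : Finset (Set Plane),
      (∀ S ∈ F, S.Nonempty ∧ IsCompact S ∧ Convex ℝ S) ∧
      (¬ ∃ G : Fin 5 → Set Plane, (∀ i, G i ∈ (F : Set (Set Plane))) ∧ IsCk 5 G) ∧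
      ¬ ∃ L : Fin 2 → Set Plane, (∀ i, IsLine (L i)) ∧
        ∀ S ∈ F, ∃ i, (S ∩ L i).Nonempty) := by
  exact ⟨upper, lower⟩
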